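/- The function h : ℂ^{n+1} → ℝ, h(x) = ‖x‖⁴ − |q(x)|², is (real) differentiable, and for every x ∈ ℂ^{n+1} and every λ ∈ ℂ its derivative at x annihilates the direction λ·x̄: Dh_x(λ·x̄) = 0. (This is the assertion dh_x(ℂx̄) = 0 from the proof of Lemma 1.2.4; since ℂx̄ is the horizontal subspace of the fibration q at x, the function h is constant under symplectic parallel transport.) -/

import Mathlib

/-! From the proof of Lemma 1.2.4 of Seidel, "A long exact sequence for symplectic
Floer cohomology": the function `h(x) = ‖x‖⁴ − |q(x)|²` is (real) differentiable and
its derivative annihilates the horizontal directions `ℂ·x̄` of the fibration `q`. -/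

/-- The standard complex quadratic form `q(x) = x₁² + ⋯ + x_{n+1}²`. -/
noncomputable def q (n : ℕ) (x : Fin (n+1) → ℂ) : ℂ := ∑ k, (x k)^2

/-- `h(x) = ‖x‖⁴ − |q(x)|²`. -/
noncomputable def hFun (n : ℕ) (x : Fin (n+1) → ℂ) : ℝ :=
  (∑ k, Complex.normSq (x k))^2 - Complex.normSq (q n x)

theorem differentiable_hFun (n : ℕ) : Differentiable ℝ (hFun n) := by
  unfold hFun q
  simp only [Complex.normSq_eq_norm_sq]
  have hsum : Differentiable ℝ fun x : Fin (n+1) → ℂ => ∑ k, (x k)^2 := by fun_prop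
  have hk (k : Fin (n+1)) : Differentiable ℝ fun x : Fin (n+1) → ℂ => ‖x k‖^2 :=
    (differentiable_apply k).norm_sq ℝ
  exact ((Differentiable.fun_sum fun k _ => hk k).pow 2).sub (hsum.norm_sq ℝ)

theorem HasDerivAt.complex_normSq {f : ℝ → ℂ} {f' : ℂ} {t : ℝ} (hf : HasDerivAt f f' t) :
    HasDerivAt (fun s => Complex.normSq (f s)) (2 * (f' * (starRingEnd ℂ) (f t)).re) t := by
  simpa only [Complex.normSq_eq_norm_sq, Complex.inner] using hf.norm_sq

theorem hasDerivAt_hFun_line (n : ℕ) (x v : Fin (n+1) → ℂ) :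
    HasDerivAt (fun t : ℝ => hFun n (x + t • v))
      (4 * (∑ k, Complex.normSq (x k)) * (∑ k, v k * (starRingEnd ℂ) (x k)).re
        - 4 * ((∑ k, x k * v k) * (starRingEnd ℂ) (q n x)).re) 0 := by
  have hline (k : Fin (n+1)) : HasDerivAt (fun t : ℝ => (x + t • v) k) (v k) 0 := by
    simpa using ((hasDerivAt_id (0 : ℝ)).smul_const (v k)).const_add (x k)
  have hN := (HasDerivAt.fun_sum (u := Finset.univ)
    fun k _ => (hline k).complex_normSq).fun_pow 2
  have hQ := (HasDerivAt.fun_sum (u := Finset.univ)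
    fun k _ => (hline k).fun_pow 2).complex_normSq
  refine (hN.sub hQ).congr_deriv ?_
  have hsum : ∑ k, 2 * x k * v k = 2 * ∑ k, x k * v k := by
    rw [Finset.mul_sum]
    exact Finset.sum_congr rfl fun k _ => mul_assoc _ _ _
  simp only [zero_smul, add_zero, Nat.cast_ofNat, Nat.add_one_sub_one, pow_one, hsum,
    ← Finset.mul_sum, ← Complex.re_sum, q]
  rw [mul_assoc (2 : ℂ)]
  simp only [Complex.mul_re (2 : ℂ), Complex.re_ofNat, Complex.im_ofNat]
  ring

theorem hFun_constant_in_horizontal_directions (n : ℕ) :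
    Differentiable ℝ (hFun n) ∧
    ∀ (x : Fin (n+1) → ℂ) (l : ℂ),
      fderiv ℝ (hFun n) x (fun k => l * (starRingEnd ℂ) (x k)) = 0 := by
  refine ⟨differentiable_hFun n, fun x l => ?_⟩
  rw [← (differentiable_hFun n x).lineDeriv_eq_fderiv, lineDeriv,
    (hasDerivAt_hFun_line n x _).deriv]
  have hq : ∑ k, l * (starRingEnd ℂ) (x k) * (starRingEnd ℂ) (x k)
      = l * (starRingEnd ℂ) (q n x) := by
    simp only [q, map_sum, map_pow, Finset.mul_sum]
    exact Finset.sum_congr rfl fun k _ => by ring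
  have hN : ∑ k, x k * (l * (starRingEnd ℂ) (x k))
      = ((∑ k, Complex.normSq (x k) : ℝ) : ℂ) * l := by
    simp only [Complex.ofReal_sum, ← Complex.mul_conj, Finset.sum_mul]
    exact Finset.sum_congr rfl fun k _ => by ring
  rw [hq, hN, mul_assoc (Complex.ofReal _), Complex.re_ofReal_mul]
  ring
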